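/- arXiv:1208.3002 — 3 statements merged into one kernel-verified Lean document; each statement's English description precedes it below -/
import Mathlib

section
/- Define w : ℝ² → ℝ by w(x) = φ(|x|) for |x| ≤ 1 and w(x) = φ'(1)·ln|x| for |x| > 1, where φ is the positive radial solution of -Δφ = φ^p in B_1(0) with zero boundary data. Then w is C¹ on ℝ² and satisfies -Δw = (w_+)^p in the sense of distributions on ℝ², where w_+ = max(w,0). -/
open MeasureTheory Real Set

/-- The Laplacian of a function on ℝ², defined through the second iterated
Fréchet derivative. -/
noncomputable def lap (u : EuclideanSpace ℝ (Fin 2) → ℝ)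
    (x : EuclideanSpace ℝ (Fin 2)) : ℝ :=
  ∑ i : Fin 2, iteratedFDeriv ℝ 2 u x
    ![EuclideanSpace.single i 1, EuclideanSpace.single i 1]

abbrev E2 := EuclideanSpace ℝ (Fin 2)

lemma hasFDerivAt_norm_aux (x : E2) (hx : x ≠ 0) :
    HasFDerivAt (fun y : E2 => ‖y‖) (‖x‖⁻¹ • innerSL ℝ x) x := by
  have hn : ‖x‖ ≠ 0 := norm_ne_zero_iff.mpr hx
  have h1 : HasFDerivAt (fun y : E2 => ‖y‖ ^ 2) (2 • innerSL ℝ x) x :=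
    (hasStrictFDerivAt_norm_sq x).hasFDerivAt
  have h2 := h1.sqrt (by positivity)
  have h3 : (fun y : E2 => √(‖y‖ ^ 2)) = fun y => ‖y‖ := by
    funext y; exact Real.sqrt_sq (norm_nonneg y)
  rw [h3] at h2
  have h4 : ‖x‖⁻¹ • innerSL ℝ x = (1 / (2 * √(‖x‖ ^ 2))) • 2 • innerSL ℝ x := by
    rw [Real.sqrt_sq (norm_nonneg x)]
    ext v
    simp
    field_simp
  rw [h4]
  exact h2

lemma radial_hasFDerivAt (g g1 : ℝ → ℝ) (hg : ∀ r, 0 ≤ r → HasDerivAt g (g1 r) r)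
    (h0 : g1 0 = 0) (x : E2) :
    HasFDerivAt (fun y : E2 => g ‖y‖) ((g1 ‖x‖ / ‖x‖) • innerSL ℝ x) x := by
  by_cases hx : x = 0
  · subst hx
    have h := hg 0 le_rfl
    rw [h0, hasDerivAt_iff_isLittleO] at h
    have ht : Filter.Tendsto (fun y : E2 => ‖y‖) (nhds 0) (nhds 0) := by
      simpa using (continuous_norm (E := E2)).tendsto 0
    have h2 := h.comp_tendsto ht
    rw [hasFDerivAt_iff_isLittleO]
    refine Asymptotics.IsLittleO.of_norm_right ?_
    simpa [Function.comp_def] using h2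
  · have h := (hg ‖x‖ (norm_nonneg x)).comp_hasFDerivAt x (hasFDerivAt_norm_aux x hx)
    rw [smul_smul, ← div_eq_mul_inv] at h
    exact h

lemma radial_cont (g1 : ℝ → ℝ) (hc : Continuous g1) (h0 : g1 0 = 0) :
    Continuous (fun x : E2 => (g1 ‖x‖ / ‖x‖) • innerSL ℝ x) := by
  rw [continuous_iff_continuousAt]
  intro x
  by_cases hx : x = 0
  · subst hx
    rw [ContinuousAt]
    simp only [norm_zero, div_zero, zero_smul]
    apply squeeze_zero_norm (a := fun x : E2 => |g1 ‖x‖|)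
    · intro y
      rw [norm_smul, innerSL_apply_norm]
      by_cases hy : y = 0
      · subst hy; simp
      · have : ‖y‖ ≠ 0 := norm_ne_zero_iff.mpr hy
        rw [norm_div, norm_norm, Real.norm_eq_abs]
        field_simp
        exact le_rfl
    · have : Continuous (fun x : E2 => |g1 ‖x‖|) := by fun_prop
      simpa [h0] using this.tendsto 0
  · have hn : ‖x‖ ≠ 0 := norm_ne_zero_iff.mpr hx
    have h1 : ContinuousAt (fun y : E2 => g1 ‖y‖) x := by fun_prop
    have h2 : ContinuousAt (fun y : E2 => ‖y‖) x := by fun_prop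
    exact (h1.div h2 hn).smul (innerSL ℝ (E := E2)).continuous.continuousAt

noncomputable def eAng (θ : ℝ) : E2 := !₂[cos θ, sin θ]

lemma eAng_cont : Continuous eAng := by
  unfold eAng
  refine (PiLp.continuous_toLp 2 _).comp ?_
  refine continuous_pi fun i => ?_
  fin_cases i <;> simp <;> fun_prop

lemma eAng_norm (θ : ℝ) : ‖eAng θ‖ = 1 := by
  simp [eAng, EuclideanSpace.norm_eq]

lemma polar_int (F : E2 → ℝ) :
    ∫ x, F x = ∫ q in Ioi (0:ℝ) ×ˢ Ioo (-π) π, q.1 * F (q.1 • eAng q.2) := by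
  have h1 := (PiLp.volume_preserving_toLp (Fin 2)).integral_comp
    (MeasurableEquiv.toLp 2 (Fin 2 → ℝ)).measurableEmbedding F
  have h2 := (volume_preserving_finTwoArrow ℝ).symm.integral_comp
    (MeasurableEquiv.finTwoArrow (α := ℝ)).symm.measurableEmbedding (fun v => F (WithLp.toLp 2 v))
  rw [← h1, ← h2, ← integral_comp_polarCoord_symm]
  refine setIntegral_congr_fun (measurableSet_Ioi.prod measurableSet_Ioo) ?_
  rintro ⟨r, θ⟩ -
  simp only [smul_eq_mul]
  congr 2
  ext i
  fin_cases i <;> simp [eAng, polarCoord, MeasurableEquiv.finTwoArrow]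

lemma intOn_aux (P : ℝ × ℝ → ℝ) (hP : Continuous P) (R : ℝ)
    (hR : ∀ q : ℝ × ℝ, R < q.1 → P q = 0) :
    IntegrableOn P (Ioi (0:ℝ) ×ˢ Ioo (-π) π) := by
  have hK : IntegrableOn P (Icc (0:ℝ) R ×ˢ Icc (-π) π) :=
    hP.continuousOn.integrableOn_compact (isCompact_Icc.prod isCompact_Icc)
  refine hK.of_forall_sdiff_eq_zero (measurableSet_Ioi.prod measurableSet_Ioo) ?_
  rintro ⟨r, θ⟩ ⟨⟨h1, h2⟩, h3⟩
  apply hR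
  by_contra! h4
  exact h3 ⟨⟨le_of_lt h1, h4⟩, ⟨h2.1.le, h2.2.le⟩⟩

lemma radial_weak (g1 f : ℝ → ℝ) (hc : Continuous g1) (hf : Continuous f)
    (hd : ∀ r, 0 < r → r ≠ 1 → HasDerivAt (fun s => s * g1 s) (-(r * f r)) r)
    (ψ : E2 → ℝ) (hψ : ContDiff ℝ 1 ψ) (hs : HasCompactSupport ψ) :
    ∫ x : E2, (g1 ‖x‖ / ‖x‖) * fderiv ℝ ψ x x = ∫ x : E2, f ‖x‖ * ψ x := by
  obtain ⟨R, hRpos, hR⟩ := hs.isCompact.isBounded.subset_closedBall_lt 0 0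
  have hz : ∀ r θ : ℝ, R < r → r • eAng θ ∉ tsupport ψ := by
    intro r θ h hm
    have := hR hm
    rw [mem_closedBall_zero_iff, norm_smul, eAng_norm, mul_one, Real.norm_eq_abs] at this
    linarith [le_abs_self r]
  have hz0 : ∀ r θ : ℝ, R < r → ψ (r • eAng θ) = 0 := fun r θ h =>
    image_eq_zero_of_notMem_tsupport (hz r θ h)
  have hz1 : ∀ r θ : ℝ, R < r → fderiv ℝ ψ (r • eAng θ) = 0 := fun r θ h =>
    image_eq_zero_of_notMem_tsupport (fun h' => hz r θ h (tsupport_fderiv_subset ℝ h'))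
  have hψ' : Continuous (fderiv ℝ ψ) := hψ.continuous_fderiv one_ne_zero
  have hψc := hψ.continuous
  have he := eAng_cont
  set A : ℝ × ℝ → ℝ := fun q => q.1 * g1 q.1 * fderiv ℝ ψ (q.1 • eAng q.2) (eAng q.2) with hA
  set B : ℝ × ℝ → ℝ := fun q => q.1 * f q.1 * ψ (q.1 • eAng q.2) with hB
  have hAc : Continuous A := by
    have : Continuous fun q : ℝ × ℝ => fderiv ℝ ψ (q.1 • eAng q.2) (eAng q.2) :=
      Continuous.clm_apply (by fun_prop) (by fun_prop)
    fun_prop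
  have hBc : Continuous B := by fun_prop
  have hAi := intOn_aux A hAc R (fun q hq => by simp [hA, hz1 q.1 q.2 hq])
  have hBi := intOn_aux B hBc R (fun q hq => by simp [hB, hz0 q.1 q.2 hq])
  have e1 : ∫ x : E2, (g1 ‖x‖ / ‖x‖) * fderiv ℝ ψ x x
      = ∫ q in Ioi (0:ℝ) ×ˢ Ioo (-π) π, A q := by
    rw [polar_int]
    refine setIntegral_congr_fun (measurableSet_Ioi.prod measurableSet_Ioo) ?_
    rintro ⟨r, θ⟩ ⟨hr, -⟩
    have hr : 0 < r := hr
    simp only [hA, norm_smul, eAng_norm, mul_one, Real.norm_eq_abs, abs_of_pos hr, map_smul,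
      smul_eq_mul]
    field_simp
  have e2 : ∫ x : E2, f ‖x‖ * ψ x = ∫ q in Ioi (0:ℝ) ×ˢ Ioo (-π) π, B q := by
    rw [polar_int]
    refine setIntegral_congr_fun (measurableSet_Ioi.prod measurableSet_Ioo) ?_
    rintro ⟨r, θ⟩ ⟨hr, -⟩
    have hr : 0 < r := hr
    simp only [hB, norm_smul, eAng_norm, mul_one, Real.norm_eq_abs, abs_of_pos hr]
    ring
  rw [e1, e2, ← sub_eq_zero, ← integral_sub hAi hBi]
  have hDi : IntegrableOn (fun q => A q - B q) (Ioi (0:ℝ) ×ˢ Ioo (-π) π) := hAi.sub hBi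
  rw [IntegrableOn, Measure.volume_eq_prod, ← Measure.prod_restrict] at hDi
  rw [Measure.volume_eq_prod, ← Measure.prod_restrict, integral_prod_symm _ hDi]
  have key : ∀ θ : ℝ, ∫ r in Ioi (0:ℝ), (A (r, θ) - B (r, θ)) = 0 := by
    intro θ
    have hsub : ∫ r in Ioi (0:ℝ), (A (r, θ) - B (r, θ))
        = ∫ r in Ioc (0:ℝ) (R + 1), (A (r, θ) - B (r, θ)) := by
      refine setIntegral_eq_of_subset_of_forall_sdiff_eq_zero measurableSet_Ioi
        Ioc_subset_Ioi_self ?_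
      rintro r ⟨h1, h2⟩
      have : R < r := by
        by_contra! h
        exact h2 ⟨h1, by linarith⟩
      simp [hA, hB, hz0 r θ this, hz1 r θ this]
    rw [hsub, ← intervalIntegral.integral_of_le (by linarith)]
    have hcont : Continuous fun r : ℝ => A (r, θ) - B (r, θ) := by fun_prop
    rw [integral_eq_of_hasDerivAt_off_countable_of_le
      (fun r => (r * g1 r) * ψ (r • eAng θ)) _ (by linarith) (countable_singleton (1:ℝ))
      (by fun_prop) ?_ (hcont.intervalIntegrable _ _)]
    · simp [hz0 (R + 1) θ (by linarith)]
    · rintro r ⟨⟨h1, h2⟩, h3⟩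
      have hl : HasDerivAt (fun r : ℝ => r • eAng θ) (eAng θ) r := by
        simpa using (hasDerivAt_id r).smul_const (eAng θ)
      have hψd : HasDerivAt (fun r : ℝ => ψ (r • eAng θ)) (fderiv ℝ ψ (r • eAng θ) (eAng θ)) r :=
        ((hψ.differentiable one_ne_zero) _).hasFDerivAt.comp_hasDerivAt r hl
      have := (hd r h1 (by simpa using h3)).mul hψd
      have e3 : A (r, θ) - B (r, θ) = -(r * f r) * ψ (r • eAng θ)
          + r * g1 r * fderiv ℝ ψ (r • eAng θ) (eAng θ) := by
        simp only [hA, hB]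
        ring
      rw [e3]
      exact this
  simp [key]

lemma weak_aux (w : E2 → ℝ) (hw : ContDiff ℝ 1 w) (k : E2 → ℝ)
    (hk : ∀ x, fderiv ℝ w x = k x • innerSL ℝ x)
    (ψ : E2 → ℝ) (hψ : ContDiff ℝ 2 ψ) (hs : HasCompactSupport ψ) :
    -∫ x, w x * lap ψ x = ∫ x, k x * fderiv ℝ ψ x x := by
  have hψ1 : ContDiff ℝ 1 (fderiv ℝ ψ) := hψ.fderiv_right (by norm_num)
  have hs1 : HasCompactSupport (fderiv ℝ ψ) := hs.fderiv ℝ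
  set b : Fin 2 → E2 := fun i => EuclideanSpace.single i 1 with hb
  have hg : ∀ i, ContDiff ℝ 1 (fun x => fderiv ℝ ψ x (b i)) := fun i =>
    hψ1.clm_apply contDiff_const
  have hgs : ∀ i, HasCompactSupport (fun x => fderiv ℝ ψ x (b i)) := fun i =>
    hs1.comp_left (g := fun L : E2 →L[ℝ] ℝ => L (b i)) (by simp)
  have hw' : Continuous (fderiv ℝ w) := hw.continuous_fderiv one_ne_zero
  have hwc := hw.continuous
  have hgc : ∀ i, Continuous (fun x => fderiv ℝ (fun x => fderiv ℝ ψ x (b i)) x (b i)) := fun i =>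
    ((hg i).continuous_fderiv one_ne_zero).clm_apply continuous_const
  have hgcs : ∀ i, HasCompactSupport (fun x => fderiv ℝ (fun x => fderiv ℝ ψ x (b i)) x (b i)) :=
    fun i => ((hgs i).fderiv ℝ).comp_left (g := fun L : E2 →L[ℝ] ℝ => L (b i)) (by simp)
  have I1 : ∀ i, Integrable (fun x => fderiv ℝ w x (b i) * fderiv ℝ ψ x (b i)) := fun i =>
    Continuous.integrable_of_hasCompactSupport
      ((hw'.clm_apply continuous_const).mul (hg i).continuous) ((hgs i).mul_left)
  have I2 : ∀ i, Integrable
      (fun x => w x * fderiv ℝ (fun x => fderiv ℝ ψ x (b i)) x (b i)) := fun i =>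
    Continuous.integrable_of_hasCompactSupport (hwc.mul (hgc i)) ((hgcs i).mul_left)
  have I3 : ∀ i, Integrable (fun x => w x * fderiv ℝ ψ x (b i)) := fun i =>
    Continuous.integrable_of_hasCompactSupport (hwc.mul (hg i).continuous) ((hgs i).mul_left)
  have ibp : ∀ i, ∫ x, w x * fderiv ℝ (fun x => fderiv ℝ ψ x (b i)) x (b i)
      = - ∫ x, fderiv ℝ w x (b i) * fderiv ℝ ψ x (b i) := fun i =>
    integral_mul_fderiv_eq_neg_fderiv_mul_of_integrable (I1 i) (I2 i) (I3 i)
      (fun x _ => hw.differentiable one_ne_zero x) (fun x _ => (hg i).differentiable one_ne_zero x)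
  have hl : ∀ x, w x * lap ψ x
      = ∑ i, w x * fderiv ℝ (fun x => fderiv ℝ ψ x (b i)) x (b i) := by
    intro x
    rw [lap, Finset.mul_sum]
    refine Finset.sum_congr rfl fun i _ => ?_
    rw [iteratedFDeriv_two_apply]
    congr 1
    rw [fderiv_clm_apply (hψ1.differentiable one_ne_zero x) (differentiableAt_const _)]
    simp [hb]
  simp_rw [hl]
  rw [integral_finsetSum _ (fun i _ => I2 i)]
  simp_rw [ibp]
  rw [Finset.sum_neg_distrib, neg_neg, ← integral_finsetSum _ (fun i _ => I1 i)]
  congr 1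
  funext x
  have hx : x = ∑ i, x i • b i := by
    ext j
    fin_cases j <;> simp [hb, Fin.sum_univ_two]
  have h2 : fderiv ℝ ψ x x = ∑ i, x i * fderiv ℝ ψ x (b i) := by
    conv_lhs => rw [show fderiv ℝ ψ x x = fderiv ℝ ψ x (∑ i, x i • b i) by rw [← hx]]
    simp [map_sum]
  rw [h2, Finset.mul_sum]
  refine Finset.sum_congr rfl fun i _ => ?_
  rw [hk]
  simp [hb, EuclideanSpace.inner_single_right]
  ring

noncomputable def prof (φ : ℝ → ℝ) (r : ℝ) : ℝ := φ (min r 1) + deriv φ 1 * log (max r 1)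
noncomputable def prof1 (φ : ℝ → ℝ) (r : ℝ) : ℝ := deriv φ (min r 1) / max r 1

lemma prof1_cont (φ : ℝ → ℝ) (h : Continuous (deriv φ)) : Continuous (prof1 φ) := by
  unfold prof1
  refine Continuous.div (by fun_prop) (by fun_prop) fun r => ?_
  have : (1:ℝ) ≤ max r 1 := le_max_right _ _
  linarith

lemma prof_deriv (φ : ℝ → ℝ) (hφ : Differentiable ℝ φ) (hb : φ 1 = 0) (r : ℝ) :
    HasDerivAt (prof φ) (prof1 φ r) r := by
  have hle : ∀ s ≤ (1:ℝ), prof φ s = φ s := fun s hs => by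
    simp [prof, min_eq_left hs, max_eq_right hs]
  have hge : ∀ s, (1:ℝ) ≤ s → prof φ s = deriv φ 1 * log s := fun s hs => by
    simp [prof, min_eq_right hs, max_eq_left hs, hb]
  have hlog : ∀ s, (1:ℝ) ≤ s → HasDerivAt (fun s => deriv φ 1 * log s) (deriv φ 1 / s) s :=
    fun s hs => by
      simpa [div_eq_mul_inv] using (Real.hasDerivAt_log (by linarith)).const_mul (deriv φ 1)
  rcases lt_trichotomy r 1 with h | h | h
  · have : prof1 φ r = deriv φ r := by simp [prof1, min_eq_left h.le, max_eq_right h.le]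
    rw [this]
    refine (hφ r).hasDerivAt.congr_of_eventuallyEq ?_
    filter_upwards [Iio_mem_nhds h] with s hs using hle s (le_of_lt hs)
  · subst h
    have e : prof1 φ 1 = deriv φ 1 := by simp [prof1]
    rw [e, ← hasDerivWithinAt_univ, ← Iic_union_Ici (a := (1:ℝ))]
    refine HasDerivWithinAt.union ?_ ?_
    · exact (hφ 1).hasDerivAt.hasDerivWithinAt.congr (fun s hs => hle s hs) (hle 1 le_rfl)
    · have := (hlog 1 le_rfl).hasDerivWithinAt (s := Ici 1)
      rw [div_one] at this
      exact this.congr (fun s hs => hge s hs) (hge 1 le_rfl)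
  · have : prof1 φ r = deriv φ 1 / r := by simp [prof1, min_eq_right h.le, max_eq_left h.le]
    rw [this]
    refine (hlog r h.le).congr_of_eventuallyEq ?_
    filter_upwards [Ioi_mem_nhds h] with s hs using hge s (le_of_lt hs)

theorem stmt2 (p : ℝ) (hp : 1 < p) (φ : ℝ → ℝ)
    (hreg : ContDiff ℝ 2 φ)
    (hpos : ∀ r ∈ Set.Ico (0:ℝ) 1, 0 < φ r)
    (hb : φ 1 = 0)
    (hode : ∀ r ∈ Set.Ioo (0:ℝ) 1,
      deriv (deriv φ) r + deriv φ r / r = -(φ r ^ p))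
    (h0 : deriv φ 0 = 0)
    (hder : deriv φ 1 < 0)
    (w : EuclideanSpace ℝ (Fin 2) → ℝ)
    (hw1 : ∀ x : EuclideanSpace ℝ (Fin 2), ‖x‖ ≤ 1 → w x = φ ‖x‖)
    (hw2 : ∀ x : EuclideanSpace ℝ (Fin 2), 1 < ‖x‖ →
      w x = deriv φ 1 * Real.log ‖x‖) :
    ContDiff ℝ 1 w ∧
      ∀ ψ : EuclideanSpace ℝ (Fin 2) → ℝ, ContDiff ℝ (⊤ : ℕ∞) ψ → HasCompactSupport ψ →
        -∫ x, w x * lap ψ x = ∫ x, max (w x) 0 ^ p * ψ x := by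
  have hd1 : Differentiable ℝ φ := hreg.differentiable two_ne_zero
  have hreg' : ContDiff ℝ 1 (deriv φ) := by
    have : ContDiff ℝ (1 + 1) φ := by norm_num; exact hreg
    exact (contDiff_succ_iff_deriv.mp this).2.2
  have hd2 : Differentiable ℝ (deriv φ) := hreg'.differentiable one_ne_zero
  have hw : w = fun x => prof φ ‖x‖ := by
    funext x
    rcases le_or_gt ‖x‖ 1 with h | h
    · rw [hw1 x h]; simp [prof, min_eq_left h, max_eq_right h]
    · rw [hw2 x h]; simp [prof, min_eq_right h.le, max_eq_left h.le, hb]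
  have hg := prof_deriv φ hd1 hb
  have hc1 := prof1_cont φ hreg'.continuous
  have h10 : prof1 φ 0 = 0 := by simp [prof1, h0]
  have hF : ∀ x : E2, HasFDerivAt w ((prof1 φ ‖x‖ / ‖x‖) • innerSL ℝ x) x := by
    intro x; rw [hw]; exact radial_hasFDerivAt _ _ (fun r _ => hg r) h10 x
  have hfd : ∀ x : E2, fderiv ℝ w x = (prof1 φ ‖x‖ / ‖x‖) • innerSL ℝ x := fun x => (hF x).fderiv
  have hC : ContDiff ℝ 1 w := by
    rw [contDiff_one_iff_fderiv]
    refine ⟨fun x => (hF x).differentiableAt, ?_⟩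
    rw [show fderiv ℝ w = _ from funext hfd]
    exact radial_cont _ hc1 h10
  refine ⟨hC, fun ψ hψ hs => ?_⟩
  rw [weak_aux w hC _ hfd ψ (hψ.of_le (WithTop.coe_le_coe.mpr le_top)) hs]
  have hgc : Continuous (prof φ) :=
    continuous_iff_continuousAt.mpr fun r => (hg r).continuousAt
  rw [radial_weak (prof1 φ) (fun r => max (prof φ r) 0 ^ p) hc1 ?_ ?_ ψ
    (hψ.of_le (WithTop.coe_le_coe.mpr le_top)) hs, hw]
  · exact (hgc.max continuous_const).rpow_const (fun _ => Or.inr (by linarith))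
  · intro r hr hr1
    rcases lt_or_gt_of_ne hr1 with h | h
    · have e1 : prof φ r = φ r := by simp [prof, min_eq_left h.le, max_eq_right h.le]
      have e2 : max (φ r) 0 = φ r := max_eq_left (hpos r ⟨hr.le, h⟩).le
      have := (hasDerivAt_id r).mul (hd2 r).hasDerivAt
      have e3 : -(r * max (prof φ r) 0 ^ p) = 1 * deriv φ r + id r * deriv (deriv φ) r := by
        rw [e1, e2]
        have := hode r ⟨hr, h⟩
        field_simp at this
        simp only [id]
        linarith
      rw [e3]
      refine this.congr_of_eventuallyEq ?_
      filter_upwards [Iio_mem_nhds h] with s hs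
      have hs : s < 1 := hs
      simp [prof1, min_eq_left hs.le, max_eq_right hs.le]
    · have e1 : prof φ r ≤ 0 := by
        have : 0 ≤ log r := Real.log_nonneg h.le
        simp only [prof, min_eq_right h.le, max_eq_left h.le, hb]
        nlinarith
      rw [max_eq_right e1, Real.zero_rpow (by linarith), mul_zero, neg_zero]
      refine (hasDerivAt_const r (deriv φ 1)).congr_of_eventuallyEq ?_
      filter_upwards [Ioi_mem_nhds h] with s hs
      have hs : 1 < s := hs
      simp only [prof1, min_eq_right hs.le, max_eq_left hs.le]
      field_simp
end

section
/- Poincaré–Miranda theorem: Let f = (f_1,…,f_n) : [a_1,b_1]×⋯×[a_n,b_n] → ℝⁿ be continuous, and suppose for each i that f_i(x) ≤ 0 whenever x_i = a_i and f_i(x) ≥ 0 whenever x_i = b_i. Then there exists a point x in the box with f(x) = 0. -/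
open Set

namespace PM

abbrev V (n N : ℕ) := Fin n → ZMod N
abbrev M (n N : ℕ) := Finset (Fin n) → V n N → ZMod 2
abbrev R (n N : ℕ) := Module.End (ZMod 2) (M n N)

variable {n N : ℕ}

/-- Grassmann variable acting on cochains. -/
def eps (a : Fin n) : R n N where
  toFun ψ := fun T z => if a ∈ T then 0 else ψ (insert a T) z
  map_add' x y := by
    funext T z; by_cases h : a ∈ T <;> simp [h]
  map_smul' c x := by
    funext T z; by_cases h : a ∈ T <;> simp [h]

/-- Translation. -/
def tau (a : Fin n) : R n N where
  toFun ψ := fun T z => ψ T (z + Pi.single a 1)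
  map_add' x y := by funext T z; simp
  map_smul' c x := by funext T z; simp

/-- Multiplication operator. -/
def mu (s : V n N → ZMod 2) : R n N where
  toFun ψ := fun T z => s z * ψ T z
  map_add' x y := by funext T z; simp [mul_add]
  map_smul' c x := by funext T z; simp [mul_left_comm]

lemma eps_apply (a : Fin n) (ψ : M n N) (T z) :
    eps a ψ T z = if a ∈ T then 0 else ψ (insert a T) z := rfl
lemma tau_apply (a : Fin n) (ψ : M n N) (T z) :
    tau a ψ T z = ψ T (z + Pi.single a 1) := rfl
lemma mu_apply (s : V n N → ZMod 2) (ψ : M n N) (T z) :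
    mu s ψ T z = s z * ψ T z := rfl

lemma eps_sq (a : Fin n) : (eps a * eps a : R n N) = 0 := by
  refine LinearMap.ext fun ψ => ?_
  funext T z
  simp [Module.End.mul_apply, eps_apply]

lemma eps_comm (a b : Fin n) : Commute (eps a : R n N) (eps b) := by
  refine LinearMap.ext fun ψ => ?_
  funext T z
  simp only [Module.End.mul_apply, eps_apply, Finset.mem_insert]
  by_cases hab : a = b
  · subst hab; rfl
  · have : b ≠ a := fun h => hab h.symm
    by_cases h1 : a ∈ T <;> by_cases h2 : b ∈ T <;> simp [h1, h2, hab, this, Finset.insert_comm]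

lemma eps_tau (a b : Fin n) : Commute (eps a : R n N) (tau b) := by
  refine LinearMap.ext fun ψ => ?_
  funext T z
  simp only [Module.End.mul_apply, eps_apply, tau_apply]

lemma eps_mu (a : Fin n) (s) : Commute (eps a : R n N) (mu s) := by
  refine LinearMap.ext fun ψ => ?_
  funext T z
  simp only [Module.End.mul_apply, eps_apply, mu_apply]
  split_ifs <;> simp

lemma tau_comm (a b : Fin n) : Commute (tau a : R n N) (tau b) := by
  refine LinearMap.ext fun ψ => ?_
  funext T z
  simp only [Module.End.mul_apply, tau_apply, add_right_comm]

/-- The total shift. -/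
def X : R n N := ∑ a, eps a * tau a

lemma two_zero (A : R n N) : A + A = 0 := by
  refine LinearMap.ext fun ψ => ?_
  funext T z
  simp only [LinearMap.add_apply, Pi.add_apply]
  exact CharTwo.add_self_eq_zero _

lemma Y_comm (a b : Fin n) : Commute (eps a * tau a : R n N) (eps b * tau b) :=
  Commute.mul_left ((eps_comm a b).mul_right (eps_tau a b))
    (((eps_tau b a).symm).mul_right (tau_comm a b))

lemma Y_sq (a : Fin n) : (eps a * tau a : R n N) * (eps a * tau a) = 0 := by
  calc (eps a * tau a : R n N) * (eps a * tau a)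
      = eps a * (tau a * eps a) * tau a := by simp only [mul_assoc]
    _ = (eps a * eps a) * tau a * tau a := by
        rw [← (eps_tau a a).eq]; simp only [mul_assoc]
    _ = 0 := by rw [eps_sq]; simp

lemma X_sq : (X : R n N) * X = 0 := by
  have key : ∀ s : Finset (Fin n),
      (∑ a ∈ s, (eps a * tau a : R n N)) * (∑ a ∈ s, (eps a * tau a : R n N)) = 0 := by
    intro s
    induction s using Finset.induction_on with
    | empty => simp
    | insert a s ha ih =>
      rw [Finset.sum_insert ha, add_mul, mul_add, mul_add, ih, Y_sq]
      have : Commute (eps a * tau a : R n N) (∑ a ∈ s, (eps a * tau a : R n N)) :=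
        Commute.sum_right _ _ _ fun b _ => Y_comm a b
      rw [this.eq, zero_add, add_zero, two_zero]
  exact key _

/-- The coboundary. -/
def d (A : R n N) : R n N := X * A + A * X

lemma d_mul (A B : R n N) : d (A * B) = d A * B + A * d B := by
  have := two_zero (A * X * B)
  calc d (A * B) = X * A * B + A * B * X + 0 := by simp [d, mul_assoc]
    _ = _ := by rw [← this]; simp only [d, mul_add, add_mul, mul_assoc]; abel

lemma d_add (A B : R n N) : d (A + B) = d A + d B := by
  simp only [d, mul_add, add_mul]; abel

lemma d_d (A : R n N) : d (d A) = 0 := by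
  have h := two_zero (X * A * X)
  have h2 := X_sq (n := n) (N := N)
  calc d (d A) = (X * X) * A + (X * A * X + X * A * X) + A * (X * X) := by
        simp only [d, mul_add, add_mul, mul_assoc]; abel
    _ = 0 := by rw [h, h2]; simp

open Classical in
/-- Wrap-around indicator. -/
noncomputable def wf (j : Fin n) : V n N → ZMod 2 := fun z => if z j = -1 then 1 else 0

/-- Wrap-around cocycle. -/
noncomputable def w (j : Fin n) : R n N := eps j * (mu (wf j) * tau j)

lemma w_comm (a j : Fin n) : Commute (eps a : R n N) (w j) :=
  (eps_comm a j).mul_right ((eps_mu a _).mul_right (eps_tau a j))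

lemma tau_w (a j : Fin n) (h : a ≠ j) : Commute (tau a : R n N) (w j) := by
  have : Commute (tau a : R n N) (mu (wf j)) := by
    refine LinearMap.ext fun ψ => ?_
    funext T z
    simp [Module.End.mul_apply, tau_apply, mu_apply, wf, h.symm]
  exact (eps_tau j a).symm.mul_right (this.mul_right (tau_comm a j))

lemma d_w (j : Fin n) : d (w j : R n N) = 0 := by
  have : Commute (X : R n N) (w j) := by
    refine Commute.sum_left _ _ _ fun a _ => ?_
    by_cases h : a = j
    · subst h
      have h1 : (eps a * tau a : R n N) * w a = 0 := by
        rw [(eps_tau a a).eq, w, mul_assoc, ← mul_assoc (eps a) (eps a), eps_sq]; simp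
      have h2 : w a * (eps a * tau a : R n N) = 0 := by
        rw [← mul_assoc, ← (w_comm a a).eq, w, ← mul_assoc (eps a) (eps a), eps_sq]; simp
      exact h1.trans h2.symm
    · exact (w_comm a j).mul_left (tau_w a j h)
  rw [d, this.eq, two_zero]

lemma X_eps (a : Fin n) : Commute (eps a : R n N) X :=
  Commute.sum_right _ _ _ fun b _ => (eps_comm a b).mul_right (eps_tau a b)

lemma d_eps (a : Fin n) (A : R n N) (h : Commute (eps a) A) : Commute (eps a) (d A) :=
  ((X_eps a).mul_right h).add_right (h.mul_right (X_eps a))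

/-- The cocycles. -/
noncomputable def C (s : Fin n → V n N → ZMod 2) (j : Fin n) : R n N := d (mu (s j)) + w j

lemma prod_C (s : Fin n → V n N → ZMod 2) (l : List (Fin n)) :
    d ((l.map (C s)).prod) = 0 ∧ (∀ a, Commute (eps a) (l.map (C s)).prod) ∧
    ∃ B : R n N, (∀ a, Commute (eps a) B) ∧ (l.map (C s)).prod = (l.map w).prod + d B := by
  induction l with
  | nil =>
    refine ⟨by simp [d, two_zero], by simp, 0, by simp, by simp [d]⟩
  | cons j l ih =>
    obtain ⟨h1, h2, B, h3, h4⟩ := ih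
    have hC : ∀ a, Commute (eps a) (C s j) := fun a =>
      (d_eps a _ (eps_mu a _)).add_right (w_comm a j)
    refine ⟨?_, ?_, w j * B + mu (s j) * (l.map (C s)).prod, ?_, ?_⟩
    · simp only [List.map_cons, List.prod_cons]
      rw [d_mul, h1, C, d_add, d_d, d_w]; simp
    · intro a
      simp only [List.map_cons, List.prod_cons]
      exact (hC a).mul_right (h2 a)
    · intro a
      exact ((w_comm a j).mul_right (h3 a)).add_right ((eps_mu a _).mul_right (h2 a))
    · simp only [List.map_cons, List.prod_cons]
      rw [d_add, d_mul, d_mul, d_w, h1, C, add_mul]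
      nth_rewrite 2 [h4]
      rw [mul_add]; simp only [zero_mul, mul_zero, add_zero, zero_add]; abel

open Classical in
/-- Base cochain. -/
noncomputable def psi0 : M n N := fun T _ => if T = Finset.univ then 1 else 0

noncomputable def phi [NeZero N] (A : R n N) : ZMod 2 := ∑ z, A psi0 ∅ z

lemma phi_add [NeZero N] (A B : R n N) : phi (A + B) = phi A + phi B := by
  simp [phi, Finset.sum_add_distrib]

lemma phi_sum [NeZero N] {ι : Type*} (s : Finset ι) (A : ι → R n N) :
    phi (∑ i ∈ s, A i) = ∑ i ∈ s, phi (A i) := by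
  classical
  induction s using Finset.induction_on with
  | empty => simp [phi]
  | insert a s ha ih => rw [Finset.sum_insert ha, Finset.sum_insert ha, phi_add, ih]

lemma phi_tau_left [NeZero N] (a : Fin n) (A : R n N) : phi (tau a * A) = phi A := by
  simp only [phi, Module.End.mul_apply, tau_apply]
  exact Fintype.sum_equiv (Equiv.addRight (Pi.single a 1)) _ _ fun z => rfl

lemma phi_tau_right [NeZero N] (a : Fin n) (A : R n N) : phi (A * tau a) = phi A := by
  have : (tau a) (psi0 : M n N) = psi0 := rfl
  simp only [phi, Module.End.mul_apply, this]

lemma phi_d [NeZero N] (B : R n N) (hB : ∀ a, Commute (eps a) B) : phi (d B) = 0 := by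
  have h1 : phi (X * B) = ∑ a, phi (eps a * B) := by
    rw [X, Finset.sum_mul, phi_sum]
    refine Finset.sum_congr rfl fun a _ => ?_
    rw [(eps_tau a a).eq, mul_assoc, phi_tau_left]
  have h2 : phi (B * X) = ∑ a, phi (eps a * B) := by
    rw [X, Finset.mul_sum, phi_sum]
    refine Finset.sum_congr rfl fun a _ => ?_
    rw [← mul_assoc, phi_tau_right, (hB a).eq]
  rw [d, phi_add, h1, h2]
  exact CharTwo.add_self_eq_zero _

open Classical in
lemma prod_w (l : List (Fin n)) : ∀ (T : Finset (Fin n)) (z : V n N), l.Nodup →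
    (∀ i, i ∈ T ↔ i ∉ l) →
    (l.map w).prod psi0 T z = if ∀ j ∈ l, z j = -1 then 1 else 0 := by
  induction l with
  | nil =>
    intro T z _ h
    have : T = Finset.univ := by ext i; simp [h]
    simp [psi0, this]
  | cons j l ih =>
    intro T z hl h
    rw [List.nodup_cons] at hl
    have hj : j ∉ T := by simp [h]
    have hT : ∀ i, i ∈ insert j T ↔ i ∉ l := by
      intro i
      rw [Finset.mem_insert, h, List.mem_cons]
      by_cases hi : i = j
      · subst hi; simp [hl.1]
      · simp [hi]
    simp only [List.map_cons, List.prod_cons, Module.End.mul_apply]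
    rw [w]
    simp only [Module.End.mul_apply, eps_apply, mu_apply, tau_apply, if_neg hj]
    rw [ih _ _ hl.2 hT]
    have : (∀ i ∈ l, (z + Pi.single j 1 : V n N) i = -1) ↔ ∀ i ∈ l, z i = -1 := by
      refine forall₂_congr fun i hi => ?_
      have : i ≠ j := fun e => hl.1 (e ▸ hi)
      simp [this]
    simp only [this, wf, List.forall_mem_cons]
    by_cases h1 : z j = -1 <;> simp [h1]

lemma phi_w [NeZero N] : phi ((((List.finRange n).map w).prod : R n N)) = 1 := by
  classical
  rw [phi]
  rw [Finset.sum_eq_single (fun _ => -1 : V n N)]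
  · rw [prod_w _ _ _ (List.nodup_finRange n) (by simp)]; simp
  · intro z _ hz
    rw [prod_w _ _ _ (List.nodup_finRange n) (by simp), if_neg]
    intro h
    exact hz (funext fun i => h i (List.mem_finRange i))
  · simp

lemma phi_C [NeZero N] (s : Fin n → V n N → ZMod 2) :
    phi ((((List.finRange n).map (C s)).prod : R n N)) = 1 := by
  obtain ⟨-, -, B, hB, h⟩ := prod_C s (List.finRange n)
  rw [h, phi_add, phi_w, phi_d B hB, add_zero]

/-- Indicator vector of a finset. -/
def ind (T : Finset (Fin n)) : V n N := fun i => if i ∈ T then 1 else 0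

lemma C_apply (s : Fin n → V n N → ZMod 2) (j : Fin n) (ψ : M n N) (T z) :
    C s j ψ T z = (∑ a, if a ∈ T then 0 else
      (s j (z + Pi.single a 1) + s j z) * ψ (insert a T) (z + Pi.single a 1)) +
      (if j ∈ T then 0 else wf j z * ψ (insert j T) (z + Pi.single j 1)) := by
  simp only [C, d, X, w, LinearMap.add_apply, Module.End.mul_apply, Pi.add_apply,
    LinearMap.sum_apply, Finset.sum_apply, eps_apply, tau_apply, mu_apply, Finset.mul_sum]
  rw [← Finset.sum_add_distrib]
  congr 1
  refine Finset.sum_congr rfl fun a _ => ?_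
  split_ifs <;> ring

lemma extract (s : Fin n → V n N → ZMod 2) (l : List (Fin n)) :
    ∀ (T : Finset (Fin n)) (z : V n N), (l.map (C s)).prod psi0 T z ≠ 0 →
    ∀ j ∈ l, ∃ T' : Finset (Fin n), ∃ a, Disjoint T' T ∧ a ∉ T' ∧ a ∉ T ∧
      s j (z + ind T' + Pi.single a 1) + s j (z + ind T') +
        (if a = j then wf j (z + ind T') else 0) ≠ 0 := by
  classical
  induction l with
  | nil => simp
  | cons k l ih =>
    intro T z h
    simp only [List.map_cons, List.prod_cons, Module.End.mul_apply] at h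
    set ψ := (l.map (C s)).prod psi0
    rw [C_apply] at h
    have e : (if k ∈ T then 0 else wf k z * ψ (insert k T) (z + Pi.single k 1)) =
        ∑ a, if a ∈ T then 0 else
          (if a = k then wf k z else 0) * ψ (insert a T) (z + Pi.single a 1) := by
      rw [Finset.sum_eq_single k]
      · simp
      · intro b _ hb; simp [hb]
      · simp
    rw [e, ← Finset.sum_add_distrib] at h
    obtain ⟨a, -, ha⟩ := Finset.exists_ne_zero_of_sum_ne_zero h
    by_cases haT : a ∈ T
    · simp [haT] at ha
    simp only [if_neg haT, ← add_mul] at ha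
    have hc := left_ne_zero_of_mul ha
    have hr := right_ne_zero_of_mul ha
    intro j hj
    rcases List.mem_cons.1 hj with rfl | hj
    · have i0 : (ind ∅ : V n N) = 0 := by funext i; simp [ind]
      refine ⟨∅, a, by simp, by simp, haT, ?_⟩
      rw [i0, add_zero]
      exact hc
    · obtain ⟨T', b, h1, h2, h3, h4⟩ := ih _ _ hr j hj
      rw [Finset.disjoint_insert_right] at h1
      rw [Finset.mem_insert, not_or] at h3
      have i1 : z + ind (insert a T') = z + Pi.single a 1 + (ind T' : V n N) := by
        funext i
        simp only [Pi.add_apply, ind, Finset.mem_insert, Pi.single_apply]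
        by_cases hi : i = a
        · subst hi; simp [h1.1]
        · simp [hi]
      refine ⟨insert a T', b, ?_, ?_, h3.2, ?_⟩
      · rw [Finset.disjoint_insert_left]; exact ⟨haT, h1.2⟩
      · rw [Finset.mem_insert, not_or]; exact ⟨h3.1, h2⟩
      · rw [i1]; exact h4

lemma combinatorial [NeZero N] (s : Fin n → V n N → ZMod 2)
    (h0 : ∀ j z, z j = 0 → s j z = 0) (h1 : ∀ j z, z j = -1 → s j z = 1) :
    ∃ z : V n N, (∀ i, z i ≠ -1) ∧ ∀ j, ∃ T T' : Finset (Fin n),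
      s j (z + ind T) = 0 ∧ s j (z + ind T') = 1 := by
  classical
  have h := phi_C s
  rw [phi] at h
  obtain ⟨z, -, hz⟩ := Finset.exists_ne_zero_of_sum_ne_zero (h.trans_ne one_ne_zero)
  have hp := extract s _ _ _ hz
  have hne : ∀ i, z i ≠ -1 := by
    intro i hi
    obtain ⟨T, a, -, haT, -, hc⟩ := hp i (List.mem_finRange i)
    by_cases ha : a = i
    · subst ha
      have e1 : (z + ind T : V n N) a = -1 := by simp [ind, haT, hi]
      have e2 : (z + ind T + Pi.single a 1 : V n N) a = 0 := by
        rw [Pi.add_apply, e1]; simp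
      rw [h0 _ _ e2, h1 _ _ e1] at hc
      simp only [wf, e1, if_true] at hc
      exact hc (by decide)
    · have e3 : (z + ind T + Pi.single a 1 : V n N) i = (z + ind T : V n N) i := by
        rw [Pi.add_apply, Pi.single_eq_of_ne (Ne.symm ha), add_zero]
      rw [if_neg ha] at hc
      by_cases hiT : i ∈ T
      · have e1 : (z + ind T : V n N) i = 0 := by simp [ind, hiT, hi]
        rw [h0 _ _ e1, h0 _ _ (e3.trans e1)] at hc
        exact hc (by decide)
      · have e1 : (z + ind T : V n N) i = -1 := by simp [ind, hiT, hi]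
        rw [h1 _ _ e1, h1 _ _ (e3.trans e1)] at hc
        exact hc (by decide)
  refine ⟨z, hne, fun j => ?_⟩
  obtain ⟨T, a, -, haT, -, hc⟩ := hp j (List.mem_finRange j)
  have hw : (if a = j then wf j (z + ind T) else 0) = 0 := by
    split_ifs with ha
    · subst ha
      have : (z + ind T : V n N) a = z a := by simp [ind, haT]
      simp [wf, this, hne a]
    · rfl
  rw [hw, add_zero] at hc
  have i1 : z + ind T + Pi.single a 1 = z + (ind (insert a T) : V n N) := by
    funext i
    simp only [Pi.add_apply, ind, Finset.mem_insert, Pi.single_apply]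
    by_cases hi : i = a
    · subst hi; simp [haT]
    · simp [hi]
  rw [i1] at hc
  have key : ∀ p q : ZMod 2, p + q ≠ 0 → (p = 0 ∧ q = 1) ∨ (q = 0 ∧ p = 1) := by decide
  rcases key _ _ hc with h | h
  · exact ⟨_, _, h.1, h.2⟩
  · exact ⟨_, _, h.1, h.2⟩

/-- Grid point. -/
noncomputable def pt (a b : Fin n → ℝ) (m : ℕ) (z : V n (m + 1)) : Fin n → ℝ :=
  fun i => a i + (b i - a i) * ((z i).val / m : ℝ)

lemma val_le (m : ℕ) (x : ZMod (m + 1)) : x.val ≤ m := Nat.lt_succ_iff.1 (ZMod.val_lt x)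

lemma val_neg_one' (m : ℕ) : (-1 : ZMod (m + 1)).val = m := ZMod.val_neg_one m

lemma pt_mem (a b : Fin n → ℝ) (hab : ∀ i, a i < b i) (m : ℕ) (z : V n (m + 1)) :
    pt a b m z ∈ Set.univ.pi fun i => Set.Icc (a i) (b i) := by
  intro i _
  have h0 : (0 : ℝ) ≤ (z i).val / m := by positivity
  have h1 : ((z i).val / m : ℝ) ≤ 1 :=
    div_le_one_of_le₀ (by exact_mod_cast val_le m (z i)) (by positivity)
  have := hab i
  constructor
  · simp only [pt]; nlinarith
  · simp only [pt]; nlinarith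

lemma pt_near (a b : Fin n → ℝ) (hab : ∀ i, a i < b i) (m : ℕ) (z : V n (m + 1))
    (hz : ∀ i, z i ≠ -1) (T : Finset (Fin n)) (i : Fin n) :
    |pt a b m (z + ind T) i - pt a b m z i| ≤ (b i - a i) / m := by
  have := hab i
  have hnn : 0 ≤ (b i - a i) / m := div_nonneg (by linarith) (by positivity)
  by_cases hi : i ∈ T
  · have e : (z + ind T : V n (m + 1)) i = z i + 1 := by simp [ind, hi]
    have hv : (z i + 1).val = (z i).val + 1 := by
      have hlt : (z i).val < m := by
        refine lt_of_le_of_ne (val_le m _) fun h => hz i ?_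
        apply ZMod.val_injective
        rw [h, val_neg_one']
      have h1 : (1 : ZMod (m + 1)).val = 1 := ZMod.val_one'' (by omega)
      rw [ZMod.val_add_of_lt (by rw [h1]; omega), h1]
    simp only [pt, e, hv]
    push_cast
    rw [show a i + (b i - a i) * (((z i).val + 1 : ℝ) / m) - (a i + (b i - a i) * ((z i).val / m))
      = (b i - a i) / m by ring, abs_of_nonneg hnn]
  · have e : (z + ind T : V n (m + 1)) i = z i := by simp [ind, hi]
    simp only [pt, e]
    simpa using hnn

end PM

/-- Poincaré–Miranda theorem. -/
theorem stmt12 (n : ℕ) (a b : Fin n → ℝ) (hab : ∀ i, a i < b i)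
    (f : (Fin n → ℝ) → (Fin n → ℝ))
    (hf : ContinuousOn f (Set.univ.pi fun i => Set.Icc (a i) (b i)))
    (h1 : ∀ x ∈ Set.univ.pi fun i => Set.Icc (a i) (b i),
      ∀ i, x i = a i → f x i ≤ 0)
    (h2 : ∀ x ∈ Set.univ.pi fun i => Set.Icc (a i) (b i),
      ∀ i, x i = b i → 0 ≤ f x i) :
    ∃ x ∈ Set.univ.pi fun i => Set.Icc (a i) (b i), f x = 0 := by
  classical
  set K : Set (Fin n → ℝ) := Set.univ.pi fun i => Set.Icc (a i) (b i) with hK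
  have hKc : IsCompact K := isCompact_univ_pi fun i => isCompact_Icc
  have hKne : K.Nonempty := ⟨a, fun i _ => ⟨le_rfl, (hab i).le⟩⟩
  obtain ⟨x0, hx0, hmin⟩ := hKc.exists_isMinOn hKne hf.norm
  refine ⟨x0, hx0, ?_⟩
  by_contra hne
  have hpos : 0 < ‖f x0‖ := norm_pos_iff.2 hne
  have hu := hKc.uniformContinuousOn_of_continuous hf
  rw [Metric.uniformContinuousOn_iff] at hu
  obtain ⟨δ, hδ, hu⟩ := hu ‖f x0‖ hpos
  -- choose the mesh
  obtain ⟨m, hm0, hm⟩ : ∃ m : ℕ, 0 < m ∧ ∀ i, (b i - a i) / m < δ := by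
    obtain ⟨m, hm⟩ := exists_nat_gt (∑ i, (b i - a i) / δ)
    refine ⟨m + 1, Nat.succ_pos m, fun i => ?_⟩
    have hi : (b i - a i) / δ ≤ ∑ i, (b i - a i) / δ :=
      Finset.single_le_sum (f := fun i => (b i - a i) / δ)
        (fun j _ => div_nonneg (by linarith [hab j]) hδ.le) (Finset.mem_univ i)
    have h3 : (b i - a i) / δ < ((m + 1 : ℕ) : ℝ) := by push_cast; linarith
    rw [div_lt_iff₀ hδ] at h3
    rw [div_lt_iff₀ (by positivity)]
    linarith
  have hmR : (m : ℝ) ≠ 0 := by positivity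
  let s : Fin n → PM.V n (m + 1) → ZMod 2 := fun j z =>
    if z j = 0 then 0 else if z j = -1 then 1 else if 0 ≤ f (PM.pt a b m z) j then 1 else 0
  have hs0 : ∀ j z, s j z = 0 → f (PM.pt a b m z) j ≤ 0 := by
    intro j z h
    simp only [s] at h
    split_ifs at h with h3 h4 h5
    · exact h1 _ (PM.pt_mem a b hab m z) j (by simp [PM.pt, h3])
    · exact absurd h one_ne_zero
    · exact absurd h one_ne_zero
    · exact (not_le.1 h5).le
  have hs1 : ∀ j z, s j z = 1 → 0 ≤ f (PM.pt a b m z) j := by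
    intro j z h
    simp only [s] at h
    split_ifs at h with h3 h4 h5
    · exact absurd h zero_ne_one
    · exact h2 _ (PM.pt_mem a b hab m z) j (by
        simp only [PM.pt, h4, PM.val_neg_one', div_self hmR]; ring)
    · exact h5
    · exact absurd h zero_ne_one
  have hne1 : (-1 : ZMod (m + 1)) ≠ 0 := by
    intro h
    have := congrArg ZMod.val h
    rw [PM.val_neg_one', ZMod.val_zero] at this
    omega
  obtain ⟨z, hz, hzs⟩ := PM.combinatorial s (fun j z h => by simp [s, h])
    (fun j z h => by simp [s, h, hne1])
  have hlt : ‖f (PM.pt a b m z)‖ < ‖f x0‖ := by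
    rw [pi_norm_lt_iff hpos]
    intro j
    have hd : ∀ T, |f (PM.pt a b m (z + PM.ind T)) j - f (PM.pt a b m z) j| < ‖f x0‖ := by
      intro T
      have h3 := hu _ (PM.pt_mem a b hab m (z + PM.ind T)) _ (PM.pt_mem a b hab m z) (by
        rw [dist_pi_lt_iff hδ]
        intro i
        rw [Real.dist_eq]
        exact (PM.pt_near a b hab m z hz T i).trans_lt (hm i))
      rw [dist_pi_lt_iff hpos] at h3
      simpa [Real.dist_eq] using h3 j
    obtain ⟨T, T', hT, hT'⟩ := hzs j
    have e1 := hs0 _ _ hT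
    have e2 := hs1 _ _ hT'
    have e3 := abs_lt.1 (hd T)
    have e4 := abs_lt.1 (hd T')
    rw [Real.norm_eq_abs, abs_lt]
    constructor <;> linarith [e3.1, e3.2, e4.1, e4.2]
  exact absurd (hmin (PM.pt_mem a b hab m z)) (not_le.2 hlt)
end

section
/- Let w : ℝ² → ℝ be defined by w(x) = φ(|x|) for |x| ≤ 1 and w(x) = φ'(1)ln|x| for |x| > 1, with φ the positive radial solution of -Δφ = φ^p in the unit disc, p > 1. Then the partial derivatives ∂w/∂x_1 and ∂w/∂x_2 are bounded on ℝ² and satisfy the linearized equation -Δv = p w_+^{p-1} v in the sense of distributions on ℝ². -/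
open MeasureTheory Real Set

lemma aux_norm_deriv (x : EuclideanSpace ℝ (Fin 2)) (hx : x ≠ 0) :
    HasFDerivAt (fun y : EuclideanSpace ℝ (Fin 2) => ‖y‖) (‖x‖⁻¹ • innerSL ℝ x) x := by
  have h1 := (hasStrictFDerivAt_norm_sq x).hasFDerivAt
  have hn : ‖x‖ ≠ 0 := norm_ne_zero_iff.2 hx
  have h2 := h1.sqrt (by positivity)
  have : (fun y : EuclideanSpace ℝ (Fin 2) => ‖y‖) = fun y : EuclideanSpace ℝ (Fin 2) => √(‖y‖^2) := by
    funext y; rw [Real.sqrt_sq (norm_nonneg y)]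
  rw [this]
  refine h2.congr_fderiv ?_
  ext v
  simp [Real.sqrt_sq (norm_nonneg x)]
  field_simp

lemma aux_inner (x : EuclideanSpace ℝ (Fin 2)) (i : Fin 2) : inner ℝ x (EuclideanSpace.single i (1:ℝ)) = x i := by
  simp [EuclideanSpace.inner_single_right]

lemma aux_coord (x : EuclideanSpace ℝ (Fin 2)) (i : Fin 2) : |x i| ≤ ‖x‖ := by
  simpa using PiLp.norm_apply_le x i

/-- gradient component -/
noncomputable def VV (Φ1 : ℝ → ℝ) (i : Fin 2) (x : EuclideanSpace ℝ (Fin 2)) : ℝ := Φ1 ‖x‖ / ‖x‖ * x i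

lemma aux_little {f : ℝ → ℝ} {a : ℝ} (hf : HasDerivAt f a 0) (hf0 : f 0 = 0)
    {ε : ℝ} (hε : 0 < ε) : ∀ᶠ x : EuclideanSpace ℝ (Fin 2) in nhds 0, |f ‖x‖ - ‖x‖ * a| ≤ ε * ‖x‖ := by
  have h1 := (hasDerivAt_iff_isLittleO_nhds_zero.1 hf).def hε
  have ht : Filter.Tendsto (fun x : EuclideanSpace ℝ (Fin 2) => ‖x‖) (nhds 0) (nhds 0) := by
    simpa using (continuous_norm (E := EuclideanSpace ℝ (Fin 2))).tendsto 0
  filter_upwards [ht.eventually h1] with x hx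
  simpa [hf0] using hx

lemma aux_grad {Φ Φ1 : ℝ → ℝ} (h1 : ∀ r, HasDerivAt Φ (Φ1 r) r) (h0 : Φ1 0 = 0) (x : EuclideanSpace ℝ (Fin 2)) :
    ∃ L : EuclideanSpace ℝ (Fin 2) →L[ℝ] ℝ, HasFDerivAt (fun y : EuclideanSpace ℝ (Fin 2) => Φ ‖y‖) L x ∧
      ∀ i, L (EuclideanSpace.single i 1) = VV Φ1 i x := by
  by_cases hx : x = 0
  · subst hx
    refine ⟨0, ?_, fun i => by simp [VV]⟩
    rw [hasFDerivAt_iff_isLittleO_nhds_zero, Asymptotics.isLittleO_iff]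
    intro ε hε
    have h2 : HasDerivAt (fun r => Φ r - Φ 0) 0 0 := by
      simpa [h0] using (h1 0).sub_const (Φ 0)
    filter_upwards [aux_little h2 (by simp) hε] with y hy
    simpa using hy
  · refine ⟨_, (h1 ‖x‖).comp_hasFDerivAt x (aux_norm_deriv x hx), fun i => ?_⟩
    simp [VV, aux_inner x]
    ring

lemma aux_hess {Φ1 Φ2 : ℝ → ℝ} (h2 : ∀ r, HasDerivAt Φ1 (Φ2 r) r) (h0 : Φ1 0 = 0)
    (i : Fin 2) (x : EuclideanSpace ℝ (Fin 2)) :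
    ∃ L : EuclideanSpace ℝ (Fin 2) →L[ℝ] ℝ, HasFDerivAt (VV Φ1 i) L x ∧
      (x = 0 → ∀ j, L (EuclideanSpace.single j 1) = Φ2 0 * if i = j then 1 else 0) ∧
      (x ≠ 0 → ∀ j, L (EuclideanSpace.single j 1) =
        (Φ2 ‖x‖ - Φ1 ‖x‖ / ‖x‖) / ‖x‖^2 * x i * x j + Φ1 ‖x‖ / ‖x‖ * if i = j then 1 else 0) := by
  have hc : HasFDerivAt (fun y : EuclideanSpace ℝ (Fin 2) => y i) (EuclideanSpace.proj i : EuclideanSpace ℝ (Fin 2) →L[ℝ] ℝ) x :=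
    (EuclideanSpace.proj i : EuclideanSpace ℝ (Fin 2) →L[ℝ] ℝ).hasFDerivAt
  by_cases hx : x = 0
  · subst hx
    refine ⟨Φ2 0 • (EuclideanSpace.proj i : EuclideanSpace ℝ (Fin 2) →L[ℝ] ℝ), ?_, fun _ j => ?_, fun h => absurd rfl h⟩
    · rw [hasFDerivAt_iff_isLittleO_nhds_zero, Asymptotics.isLittleO_iff]
      intro ε hε
      filter_upwards [aux_little (h2 0) h0 hε] with y hy
      by_cases hy0 : y = 0
      · subst hy0; simp [VV]
      have hn : 0 < ‖y‖ := norm_pos_iff.2 hy0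
      have e : VV Φ1 i (0 + y) - VV Φ1 i 0 - (Φ2 0 • (EuclideanSpace.proj i : EuclideanSpace ℝ (Fin 2) →L[ℝ] ℝ)) y
          = (Φ1 ‖y‖ - ‖y‖ * Φ2 0) * (y i / ‖y‖) := by
        simp [VV]; field_simp
      rw [e, norm_mul]
      have h3 : ‖y i / ‖y‖‖ ≤ 1 := by
        rw [norm_div, norm_norm, div_le_one hn]; exact aux_coord y i
      calc _ ≤ (ε * ‖y‖) * 1 := by
            apply mul_le_mul hy h3 (norm_nonneg _) (by positivity)
        _ = _ := by ring
    · simp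
  · have hn : ‖x‖ ≠ 0 := norm_ne_zero_iff.2 hx
    have hd : HasDerivAt (fun r => Φ1 r / r) ((Φ2 ‖x‖ * ‖x‖ - Φ1 ‖x‖ * 1) / ‖x‖^2) ‖x‖ :=
      (h2 ‖x‖).div (hasDerivAt_id _) hn
    have := (hd.comp_hasFDerivAt x (aux_norm_deriv x hx)).mul hc
    refine ⟨_, this, fun h => absurd h hx, fun _ j => ?_⟩
    simp [aux_inner x]
    field_simp
    split_ifs <;> ring

lemma aux_ibp {f χ : EuclideanSpace ℝ (Fin 2) → ℝ} (v : EuclideanSpace ℝ (Fin 2)) (hf : Differentiable ℝ f) (hχ : ContDiff ℝ 1 χ)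
    (hs : HasCompactSupport χ) (hi : Integrable (fun x => fderiv ℝ f x v * χ x)) :
    ∫ x, f x * fderiv ℝ χ x v = - ∫ x, fderiv ℝ f x v * χ x := by
  apply integral_mul_fderiv_eq_neg_fderiv_mul_of_integrable hi
  · apply Continuous.integrable_of_hasCompactSupport
    · exact hf.continuous.mul ((hχ.continuous_fderiv (by simp)).clm_apply continuous_const)
    · exact (hs.fderiv_apply (𝕜 := ℝ) v).mul_left
  · exact (hf.continuous.mul hχ.continuous).integrable_of_hasCompactSupport hs.mul_left
  · exact fun x _ => hf x
  · exact fun x _ => hχ.differentiable (by simp) x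

lemma aux_pos_pow {p : ℝ} (hp : 1 < p) (t : ℝ) :
    HasDerivAt (fun t : ℝ => max t 0 ^ p) (p * max t 0 ^ (p - 1)) t := by
  rcases lt_trichotomy t 0 with h | h | h
  · have : (fun t : ℝ => max t 0 ^ p) =ᶠ[nhds t] fun _ => 0 := by
      filter_upwards [Iio_mem_nhds h] with s hs
      rw [max_eq_right (le_of_lt hs), Real.zero_rpow (by linarith)]
    rw [max_eq_right h.le, Real.zero_rpow (by linarith), mul_zero]
    exact (hasDerivAt_const t (0:ℝ)).congr_of_eventuallyEq this
  · subst h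
    have h1 : HasDerivWithinAt (fun t : ℝ => max t 0 ^ p) (p * max 0 0 ^ (p - 1)) (Iic 0) 0 := by
      rw [max_self, Real.zero_rpow (by linarith), mul_zero]
      refine (hasDerivWithinAt_const (0:ℝ) (Iic 0) (0:ℝ)).congr (fun s hs => ?_) ?_
      · rw [max_eq_right hs, Real.zero_rpow (by linarith)]
      · rw [max_self, Real.zero_rpow (by linarith)]
    have h2 : HasDerivWithinAt (fun t : ℝ => max t 0 ^ p) (p * max 0 0 ^ (p - 1)) (Ici 0) 0 := by
      rw [max_self]
      refine (Real.hasDerivAt_rpow_const (Or.inr hp.le)).hasDerivWithinAt.congr (fun s hs => ?_) ?_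
      · rw [max_eq_left hs]
      · rw [max_self]
    have := h1.union h2
    rwa [Iic_union_Ici, hasDerivWithinAt_univ] at this
  · have : (fun t : ℝ => max t 0 ^ p) =ᶠ[nhds t] fun t => t ^ p := by
      filter_upwards [Ioi_mem_nhds h] with s hs
      rw [max_eq_left (le_of_lt hs)]
    rw [max_eq_left h.le]
    exact (Real.hasDerivAt_rpow_const (Or.inr hp.le)).congr_of_eventuallyEq this

lemma aux_glue {f g : ℝ → ℝ} {f' g' : ℝ → ℝ} (hf : ∀ r, HasDerivAt f (f' r) r)
    (hg : ∀ r, 1 ≤ r → HasDerivAt g (g' r) r) (h0 : f 1 = g 1) (h1 : f' 1 = g' 1) (r : ℝ) :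
    HasDerivAt (fun r => if r ≤ 1 then f r else g r) (if r ≤ 1 then f' r else g' r) r := by
  rcases lt_trichotomy r 1 with h | h | h
  · rw [if_pos h.le]
    refine (hf r).congr_of_eventuallyEq ?_
    filter_upwards [Iio_mem_nhds h] with s hs
    rw [if_pos (le_of_lt hs)]
  · subst h
    rw [if_pos le_rfl]
    have a : HasDerivWithinAt (fun r => if r ≤ 1 then f r else g r) (f' 1) (Iic 1) 1 := by
      refine (hf 1).hasDerivWithinAt.congr (fun s hs => ?_) ?_
      · rw [if_pos (mem_Iic.1 hs)]
      · rw [if_pos le_rfl]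
    have b : HasDerivWithinAt (fun r => if r ≤ 1 then f r else g r) (f' 1) (Ici 1) 1 := by
      rw [h1]
      refine (hg 1 le_rfl).hasDerivWithinAt.congr (fun s hs => ?_) ?_
      · rcases eq_or_lt_of_le (mem_Ici.1 hs) with h | h
        · rw [← h, if_pos le_rfl, h0]
        · rw [if_neg (not_le.2 h)]
      · rw [if_pos le_rfl, h0]
    have := a.union b
    rwa [Iic_union_Ici, hasDerivWithinAt_univ] at this
  · rw [if_neg (not_le.2 h)]
    refine (hg r h.le).congr_of_eventuallyEq ?_
    filter_upwards [Ioi_mem_nhds h] with s hs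
    rw [if_neg (not_le.2 hs)]

/-- Radial version of the result. -/
lemma aux_main (p : ℝ) (hp : 1 < p) (Φ Φ1 Φ2 : ℝ → ℝ) (M : ℝ)
    (h1 : ∀ r, HasDerivAt Φ (Φ1 r) r) (h2 : ∀ r, HasDerivAt Φ1 (Φ2 r) r) (h0 : Φ1 0 = 0)
    (hM1 : ∀ r, 0 ≤ r → |Φ1 r| ≤ M) (hM2 : ∀ r, 0 ≤ r → |Φ2 r| ≤ M)
    (hode : ∀ r, 0 < r → Φ2 r + Φ1 r / r = - (max (Φ r) 0 ^ p))
    (w : EuclideanSpace ℝ (Fin 2) → ℝ) (hw : ∀ x, w x = Φ ‖x‖) (h : Fin 2) :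
    (∃ C : ℝ, ∀ x, |fderiv ℝ w x (EuclideanSpace.single h 1)| ≤ C) ∧
    ∀ ψ : EuclideanSpace ℝ (Fin 2) → ℝ, ContDiff ℝ (⊤ : ℕ∞) ψ → HasCompactSupport ψ →
      ∫ x, fderiv ℝ w x (EuclideanSpace.single h 1) * (-(lap ψ x))
        = ∫ x, p * max (w x) 0 ^ (p - 1)
            * fderiv ℝ w x (EuclideanSpace.single h 1) * ψ x := by
  have hM : 0 ≤ M := (abs_nonneg _).trans (hM1 0 le_rfl)
  have hwe : w = fun x => Φ ‖x‖ := funext hw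
  have hgrad : ∀ i x, fderiv ℝ w x (EuclideanSpace.single i 1) = VV Φ1 i x := by
    intro i x
    obtain ⟨L, hL, hL'⟩ := aux_grad h1 h0 x
    rw [hwe, hL.fderiv, hL']
  have hwd : Differentiable ℝ w := by
    intro x
    obtain ⟨L, hL, hL'⟩ := aux_grad h1 h0 x
    rw [hwe]; exact hL.differentiableAt
  have hVd : ∀ i, Differentiable ℝ (VV Φ1 i) := by
    intro i x
    obtain ⟨L, hL, -⟩ := aux_hess h2 h0 i x
    exact hL.differentiableAt
  have hVb : ∀ i x, |VV Φ1 i x| ≤ M := by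
    intro i x
    unfold VV
    by_cases hx : x = 0
    · simpa [hx] using hM
    have hn : 0 < ‖x‖ := norm_pos_iff.2 hx
    rw [div_mul_eq_mul_div, abs_div, abs_mul, abs_of_pos hn, div_le_iff₀ hn]
    exact mul_le_mul (hM1 _ hn.le) (aux_coord x i) (abs_nonneg _) hM
  have hP : ∀ r, 0 < r → |Φ1 r / r| ≤ M := by
    intro r hr
    have := Convex.norm_image_sub_le_of_norm_hasDerivWithin_le (f := Φ1) (f' := Φ2) (C := M)
      (s := Ici 0) (x := 0) (y := r) (fun x _ => (h2 x).hasDerivWithinAt)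
      (fun x hx => hM2 x hx) (convex_Ici 0) (by simp) hr.le
    rw [abs_div, div_le_iff₀ (abs_pos.2 hr.ne')]
    simpa [h0] using this
  have hHb : ∀ i j x, |fderiv ℝ (VV Φ1 i) x (EuclideanSpace.single j 1)| ≤ 3 * M := by
    intro i j x
    obtain ⟨L, hL, ha, hb⟩ := aux_hess h2 h0 i x
    rw [hL.fderiv]
    by_cases hx : x = 0
    · rw [ha hx]
      have := hM2 0 le_rfl
      split_ifs <;> simp <;> linarith
    · rw [hb hx]
      have hn : 0 < ‖x‖ := norm_pos_iff.2 hx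
      have e1 : |(Φ2 ‖x‖ - Φ1 ‖x‖ / ‖x‖) / ‖x‖^2 * x i * x j| ≤ 2 * M := by
        have : (Φ2 ‖x‖ - Φ1 ‖x‖ / ‖x‖) / ‖x‖^2 * x i * x j =
          (Φ2 ‖x‖ - Φ1 ‖x‖ / ‖x‖) * ((x i * x j) / ‖x‖^2) := by ring
        rw [this, abs_mul]
        have q : |(x i * x j) / ‖x‖^2| ≤ 1 := by
          rw [abs_div, abs_mul, abs_of_pos (pow_pos hn 2), div_le_one (pow_pos hn 2), sq]
          exact mul_le_mul (aux_coord x i) (aux_coord x j) (abs_nonneg _) hn.le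
        have q2 : |Φ2 ‖x‖ - Φ1 ‖x‖ / ‖x‖| ≤ 2 * M := by
          refine (abs_sub _ _).trans ?_
          linarith [hM2 _ hn.le, hP _ hn]
        calc _ ≤ 2 * M * 1 := mul_le_mul q2 q (abs_nonneg _) (by linarith)
          _ = _ := by ring
      have e2 : |Φ1 ‖x‖ / ‖x‖ * (if i = j then 1 else 0)| ≤ M := by
        have := hP _ hn
        split_ifs
        · simpa using this
        · simpa using hM
      refine (abs_add_le _ _).trans (by linarith)
  have hsym : ∀ i j x, fderiv ℝ (VV Φ1 i) x (EuclideanSpace.single j 1) =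
      fderiv ℝ (VV Φ1 j) x (EuclideanSpace.single i 1) := by
    intro i j x
    obtain ⟨L, hL, ha, hb⟩ := aux_hess h2 h0 i x
    obtain ⟨L', hL', ha', hb'⟩ := aux_hess h2 h0 j x
    rw [hL.fderiv, hL'.fderiv]
    by_cases hx : x = 0
    · rw [ha hx, ha' hx]; simp [eq_comm]
    · rw [hb hx, hb' hx]; simp only [eq_comm (a := j)]; ring
  have hdiv : ∀ x, x ≠ 0 → ∑ i, fderiv ℝ (VV Φ1 i) x (EuclideanSpace.single i 1) =
      - (max (w x) 0 ^ p) := by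
    intro x hx
    have hn : 0 < ‖x‖ := norm_pos_iff.2 hx
    have hs : ‖x‖^2 = x 0 ^ 2 + x 1 ^ 2 := by
      rw [EuclideanSpace.norm_sq_eq]; simp
    have : ∀ i, fderiv ℝ (VV Φ1 i) x (EuclideanSpace.single i 1) =
      (Φ2 ‖x‖ - Φ1 ‖x‖ / ‖x‖) / ‖x‖^2 * x i * x i + Φ1 ‖x‖ / ‖x‖ := by
      intro i
      obtain ⟨L, hL, ha, hb⟩ := aux_hess h2 h0 i x
      rw [hL.fderiv, hb hx]; simp
    rw [hw, ← hode _ hn, Fin.sum_univ_two, this, this]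
    have : (Φ2 ‖x‖ - Φ1 ‖x‖ / ‖x‖) / ‖x‖^2 * (x 0 ^ 2 + x 1 ^ 2) = Φ2 ‖x‖ - Φ1 ‖x‖ / ‖x‖ := by
      rw [← hs]; field_simp
    linear_combination this
  refine ⟨⟨M, fun x => by rw [hgrad]; exact hVb h x⟩, ?_⟩
  intro ψ hψ hsupp
  set e : Fin 2 → EuclideanSpace ℝ (Fin 2) := fun i => EuclideanSpace.single i 1 with he
  -- derivatives of the test function
  let D : Fin 2 → EuclideanSpace ℝ (Fin 2) → ℝ := fun i x => fderiv ℝ ψ x (e i)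
  have hψ' : ContDiff ℝ (⊤ : ℕ∞) (fderiv ℝ ψ) := hψ.fderiv_right (by simp)
  have hD : ∀ i, ContDiff ℝ 1 (D i) := fun i =>
    (hψ'.clm_apply contDiff_const).of_le (by exact_mod_cast le_top)
  have hDs : ∀ i, HasCompactSupport (D i) := fun i => hsupp.fderiv_apply (𝕜 := ℝ) (e i)
  have hDD : ∀ i j x, fderiv ℝ (D i) x (e j) = fderiv ℝ (fderiv ℝ ψ) x (e j) (e i) := by
    intro i j x
    have hx : DifferentiableAt ℝ (fderiv ℝ ψ) x := hψ'.differentiable (by simp) x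
    have := (hx.hasFDerivAt.clm_apply (hasFDerivAt_const (e i) x)).fderiv
    change fderiv ℝ (fun y => fderiv ℝ ψ y (e i)) x (e j) = _
    rw [this]; simp
  have hDsym : ∀ i j x, fderiv ℝ (D i) x (e j) = fderiv ℝ (D j) x (e i) := by
    intro i j x
    rw [hDD, hDD]
    exact second_derivative_symmetric
      (fun y => (hψ.differentiable (by simp) y).hasFDerivAt)
      ((hψ'.differentiable (by simp) x).hasFDerivAt) _ _
  have hlap : ∀ x, lap ψ x = ∑ i, fderiv ℝ (D i) x (e i) := by
    intro x
    unfold lap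
    refine Finset.sum_congr rfl fun i _ => ?_
    rw [iteratedFDeriv_two_apply, hDD]; rfl
  have hint : ∀ i j k, Integrable (fun x => fderiv ℝ (VV Φ1 i) x (e j) * D k x) := by
    intro i j k
    refine Integrable.bdd_mul (c := 3 * M)
      ((hD k).continuous.integrable_of_hasCompactSupport (hDs k)) ?_ ?_
    · exact (measurable_fderiv_apply_const ℝ _ _).aestronglyMeasurable
    · exact Filter.Eventually.of_forall fun x => hHb i j x
  have hint2 : ∀ i j k, Integrable (fun x => VV Φ1 i x * fderiv ℝ (D k) x (e j)) := by
    intro i j k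
    apply Continuous.integrable_of_hasCompactSupport
    · exact (hVd i).continuous.mul (((hD k).continuous_fderiv (by simp)).clm_apply continuous_const)
    · exact ((hDs k).fderiv_apply (𝕜 := ℝ) (e j)).mul_left
  have hibp : ∀ i j k, ∫ x, VV Φ1 i x * fderiv ℝ (D k) x (e j) =
      - ∫ x, fderiv ℝ (VV Φ1 i) x (e j) * D k x := fun i j k =>
    aux_ibp (e j) (hVd i) (hD k) (hDs k) (hint i j k)
  have hstep : ∀ i, ∫ x, VV Φ1 h x * fderiv ℝ (D i) x (e i) =
      - ∫ x, fderiv ℝ (VV Φ1 i) x (e i) * D h x := by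
    intro i
    calc _ = - ∫ x, fderiv ℝ (VV Φ1 h) x (e i) * D i x := hibp h i i
      _ = - ∫ x, fderiv ℝ (VV Φ1 i) x (e h) * D i x := by simp only [he, hsym h i]
      _ = ∫ x, VV Φ1 i x * fderiv ℝ (D i) x (e h) := (hibp i h i).symm
      _ = ∫ x, VV Φ1 i x * fderiv ℝ (D h) x (e i) := by simp only [hDsym i h]
      _ = _ := hibp i i h
  have hFd : ∀ x, HasFDerivAt (fun x => max (w x) 0 ^ p)
      ((p * max (w x) 0 ^ (p - 1)) • fderiv ℝ w x) x := fun x =>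
    (aux_pos_pow hp (w x)).comp_hasFDerivAt x (hwd x).hasFDerivAt
  have hFe : ∀ x, fderiv ℝ (fun x => max (w x) 0 ^ p) x (e h) =
      p * max (w x) 0 ^ (p - 1) * VV Φ1 h x := by
    intro x
    rw [(hFd x).fderiv, ← hgrad]; simp [he]
  have hF : ∫ x, max (w x) 0 ^ p * D h x =
      - ∫ x, p * max (w x) 0 ^ (p - 1) * VV Φ1 h x * ψ x := by
    have := aux_ibp (f := fun x => max (w x) 0 ^ p) (χ := ψ) (e h)
      (fun x => (hFd x).differentiableAt) (hψ.of_le (by exact_mod_cast le_top)) hsupp (by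
        simp only [hFe]
        apply Continuous.integrable_of_hasCompactSupport
        · refine Continuous.mul (Continuous.mul (continuous_const.mul ?_) (hVd h).continuous)
            hψ.continuous
          exact (hwd.continuous.max continuous_const).rpow_const (fun x => Or.inr (by linarith))
        · exact hsupp.mul_left)
    simpa only [hFe] using this
  simp only [hgrad]
  calc ∫ x, VV Φ1 h x * (-(lap ψ x))
      = ∫ x, - ∑ i, VV Φ1 h x * fderiv ℝ (D i) x (e i) := by
        simp only [hlap, Finset.mul_sum, mul_neg]
    _ = - ∑ i, ∫ x, VV Φ1 h x * fderiv ℝ (D i) x (e i) := by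
        rw [integral_neg, integral_finsetSum _ (fun i _ => hint2 h i i)]
    _ = ∑ i, ∫ x, fderiv ℝ (VV Φ1 i) x (e i) * D h x := by
        simp only [hstep, Finset.sum_neg_distrib, neg_neg]
    _ = ∫ x, ∑ i, fderiv ℝ (VV Φ1 i) x (e i) * D h x := by
        rw [integral_finsetSum _ (fun i _ => hint i i h)]
    _ = ∫ x, -(max (w x) 0 ^ p * D h x) := by
        apply integral_congr_ae
        have : ∀ᵐ x : (EuclideanSpace ℝ (Fin 2)) ∂volume, x ≠ 0 := by
          simp [ae_iff, measure_singleton]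
        filter_upwards [this] with x hx
        rw [← Finset.sum_mul, hdiv x hx]; ring
    _ = _ := by rw [integral_neg, hF, neg_neg]

/-- The partial derivatives ∂w/∂x_h of the glued function w are
bounded on ℝ² and solve the linearized equation -Δv = p w₊^{p-1} v in the
sense of distributions. -/
theorem stmt15 (p : ℝ) (hp : 1 < p) (φ : ℝ → ℝ)
    (hreg : ContDiff ℝ 2 φ)
    (hpos : ∀ r ∈ Set.Ico (0:ℝ) 1, 0 < φ r)
    (hb : φ 1 = 0)
    (hode : ∀ r ∈ Set.Ioo (0:ℝ) 1,
      deriv (deriv φ) r + deriv φ r / r = -(φ r ^ p))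
    (h0 : deriv φ 0 = 0)
    (hder : deriv φ 1 < 0)
    (w : EuclideanSpace ℝ (Fin 2) → ℝ)
    (hw1 : ∀ x : EuclideanSpace ℝ (Fin 2), ‖x‖ ≤ 1 → w x = φ ‖x‖)
    (hw2 : ∀ x : EuclideanSpace ℝ (Fin 2), 1 < ‖x‖ →
      w x = deriv φ 1 * Real.log ‖x‖)
    (h : Fin 2) :
    (∃ C : ℝ, ∀ x, |fderiv ℝ w x (EuclideanSpace.single h 1)| ≤ C) ∧
    ∀ ψ : EuclideanSpace ℝ (Fin 2) → ℝ, ContDiff ℝ (⊤ : ℕ∞) ψ → HasCompactSupport ψ →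
      ∫ x, fderiv ℝ w x (EuclideanSpace.single h 1) * (-(lap ψ x))
        = ∫ x, p * max (w x) 0 ^ (p - 1)
            * fderiv ℝ w x (EuclideanSpace.single h 1) * ψ x := by
  set c := deriv φ 1 with hc
  have hr1 : ContDiff ℝ 1 (deriv φ) := by
    have := (contDiff_succ_iff_deriv (n := 1) (f := φ) (𝕜 := ℝ)).1 (by rw [one_add_one_eq_two]; exact hreg)
    exact this.2.2
  have d1 : ∀ r, HasDerivAt φ (deriv φ r) r := fun r =>
    (hreg.differentiable (by simp) r).hasDerivAt
  have d2 : ∀ r, HasDerivAt (deriv φ) (deriv (deriv φ) r) r := fun r =>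
    (hr1.differentiable (by simp) r).hasDerivAt
  have c2 : Continuous (deriv (deriv φ)) := hr1.continuous_deriv le_rfl
  have c1 : Continuous (deriv φ) := hr1.continuous
  -- the equation at the boundary
  have hone : deriv (deriv φ) 1 = -c := by
    have t1 : Filter.Tendsto (fun r => deriv (deriv φ) r + deriv φ r / r) (nhdsWithin 1 (Iio 1))
        (nhds (deriv (deriv φ) 1 + deriv φ 1 / 1)) := by
      apply Filter.Tendsto.mono_left _ nhdsWithin_le_nhds
      exact (c2.tendsto 1).add ((c1.tendsto 1).div Filter.tendsto_id (by simp))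
    have t2 : Filter.Tendsto (fun r => -(φ r ^ p)) (nhdsWithin 1 (Iio 1))
        (nhds (-(φ 1 ^ p))) := by
      apply Filter.Tendsto.mono_left _ nhdsWithin_le_nhds
      exact ((hreg.continuous.rpow_const (fun x => Or.inr (by linarith))).neg).tendsto 1
    have ev : (fun r => deriv (deriv φ) r + deriv φ r / r) =ᶠ[nhdsWithin 1 (Iio 1)]
        (fun r => -(φ r ^ p)) := by
      filter_upwards [Ioo_mem_nhdsLT (show (0:ℝ) < 1 by norm_num)] with r hr
      exact hode r hr
    have := tendsto_nhds_unique (t1.congr' ev) t2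
    rw [hb, Real.zero_rpow (by linarith)] at this
    simp at this
    linarith
  obtain ⟨M1, hM1⟩ := (isCompact_Icc (a := (0:ℝ)) (b := 1)).exists_bound_of_continuousOn
    c1.continuousOn
  obtain ⟨M2, hM2⟩ := (isCompact_Icc (a := (0:ℝ)) (b := 1)).exists_bound_of_continuousOn
    c2.continuousOn
  have g1 := aux_glue (f := φ) (g := fun r => c * Real.log r) (g' := fun r => c / r) d1
    (fun r hr => by
      simpa [div_eq_mul_inv] using (Real.hasDerivAt_log (by positivity)).const_mul c)
    (by simp [hb]) (by simp [hc])
  have g2 := aux_glue (f := deriv φ) (g := fun r => c / r) (g' := fun r => - c / r ^ 2) d2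
    (fun r hr => by
      have := (hasDerivAt_inv (show r ≠ 0 by positivity)).const_mul c
      refine (this.congr_deriv ?_).congr_of_eventuallyEq (Filter.Eventually.of_forall fun s => ?_)
      · ring
      · simp [div_eq_mul_inv])
    (by simp [hc]) (by simp [hone])
  refine aux_main p hp _ _ _ (max (max M1 M2) |c|) g1 g2 (by simp [h0]) ?_ ?_ ?_ w ?_ h
  · intro r hr
    split_ifs with h1
    · exact (hM1 r ⟨hr, h1⟩).trans ((le_max_left _ _).trans (le_max_left _ _))
    · refine le_trans ?_ (le_max_right _ _)
      rw [abs_div, abs_of_nonneg hr]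
      exact div_le_self (abs_nonneg _) (not_le.1 h1).le
  · intro r hr
    split_ifs with h1
    · exact (hM2 r ⟨hr, h1⟩).trans ((le_max_right _ _).trans (le_max_left _ _))
    · refine le_trans ?_ (le_max_right _ _)
      rw [abs_div, abs_neg, abs_of_nonneg (sq_nonneg r)]
      exact div_le_self (abs_nonneg _) (one_le_pow₀ (not_le.1 h1).le)
  · intro r hr
    rcases lt_trichotomy r 1 with h1 | h1 | h1
    · simp only [if_pos h1.le]
      rw [max_eq_left (hpos r ⟨hr.le, h1⟩).le]
      exact hode r ⟨hr, h1⟩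
    · subst h1
      simp [hone, hb, Real.zero_rpow (show p ≠ 0 by linarith), hc]
    · simp only [if_neg (not_le.2 h1)]
      rw [max_eq_right (mul_nonpos_of_nonpos_of_nonneg hder.le (Real.log_nonneg h1.le)),
        Real.zero_rpow (by linarith)]
      field_simp
      ring
  · intro x
    split_ifs with h1
    · exact hw1 x h1
    · exact hw2 x (not_le.1 h1)
end
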